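/- arXiv:1807.06864 — 2 statements merged into one kernel-verified Lean document; each statement's English description precedes it below -/
import Mathlib

section
/- For every commuting n-tuple (A_1, …, A_n) of real orthogonal k×k matrices, there exist k' ≥ 0 and a commuting n-tuple (B_1, …, B_n) of real orthogonal k'×k' matrices such that the commuting n-tuple of block-sum matrices (A_1 ⊕ B_1, …, A_n ⊕ B_n) lies in the path component of the identity tuple (I, …, I) in C_n(O(k + k')). (In other words, the monoid of path components of commuting tuples of orthogonal matrices under block sum is group-like.) -/
/-- The block sum `A ⊕ B` of a `k × k` matrix and a `k' × k'` matrix, as a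
`(k + k') × (k + k')` matrix. -/
def blockSum {k k' : ℕ} (A : Matrix (Fin k) (Fin k) ℝ) (B : Matrix (Fin k') (Fin k') ℝ) :
    Matrix (Fin (k + k')) (Fin (k + k')) ℝ :=
  Matrix.reindex finSumFinEquiv finSumFinEquiv (Matrix.fromBlocks A 0 0 B)

open Complex NormedSpace in
/-- A unitary with finite spectrum is the exponential of its (discontinuous) argument. -/
theorem exp_arg_of_finite {A : Type*} [CStarAlgebra A] (u : unitary A)
    (hfin : (spectrum ℂ (u : A)).Finite) :
    ((selfAdjoint.expUnitary (Unitary.argSelfAdjoint u) : unitary A) : A) = u := by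
  have : ContinuousOn arg (spectrum ℂ (u : A)) := hfin.continuousOn arg
  rw [selfAdjoint.expUnitary_coe, Unitary.argSelfAdjoint_coe,
    ← CFC.exp_eq_normedSpace_exp (𝕜 := ℂ), ← cfc_comp_smul .., ← cfc_comp' ..]
  conv_rhs => rw [← cfc_id' ℂ (u : A)]
  refine cfc_congr fun y hy ↦ ?_
  have hy₁ : ‖y‖ = 1 := spectrum.norm_eq_one_of_unitary u.2 hy
  have : I * y.arg = log y :=
    Complex.ext (by simp [log_re, hy₁]) (by simp [log_im])
  simpa [← exp_eq_exp_ℂ, this] using exp_log (by aesop)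

/-- If a unitary `u` commutes with `b`, so does `star u`. -/
theorem commute_star_of_unitary {A : Type*} [CStarAlgebra A] (u : unitary A) (b : A)
    (h : Commute (u : A) b) : Commute (star (u : A)) b := by
  have h1 : star (u : A) * u = 1 := Unitary.coe_star_mul_self u
  have h2 : (u : A) * star (u : A) = 1 := Unitary.coe_mul_star_self u
  calc star (u : A) * b = star (u : A) * (b * (u * star (u : A))) := by rw [h2, mul_one]
    _ = star (u : A) * ((u * b) * star (u : A)) := by rw [h.eq, mul_assoc]
    _ = (star (u : A) * u) * b * star (u : A) := by simp only [mul_assoc]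
    _ = b * star (u : A) := by rw [h1, one_mul]

theorem commute_arg {A : Type*} [CStarAlgebra A] (u v : unitary A)
    (h : Commute (u : A) (v : A)) :
    Commute (Unitary.argSelfAdjoint u : A) (Unitary.argSelfAdjoint v : A) := by
  simp only [Unitary.argSelfAdjoint_coe]
  have key : ∀ b : A, Commute (u : A) b → Commute (cfc (fun z : ℂ => (z.arg : ℂ)) (u : A)) b :=
    fun b hb => hb.cfc (commute_star_of_unitary u b hb) _
  have key' : ∀ b : A, Commute (v : A) b → Commute (cfc (fun z : ℂ => (z.arg : ℂ)) (v : A)) b :=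
    fun b hb => hb.cfc (commute_star_of_unitary v b hb) _
  exact (key' _ (key _ h).symm).symm

/-- Realification of a complex matrix. -/
noncomputable def realify {k : ℕ} (M : Matrix (Fin k) (Fin k) ℂ) :
    Matrix (Fin (k + k)) (Fin (k + k)) ℝ :=
  Matrix.reindex finSumFinEquiv finSumFinEquiv
    (Matrix.fromBlocks (M.map Complex.re) (-(M.map Complex.im)) (M.map Complex.im)
      (M.map Complex.re))

theorem realify_one {k : ℕ} : realify (1 : Matrix (Fin k) (Fin k) ℂ) = 1 := by
  have h1 : (1 : Matrix (Fin k) (Fin k) ℂ).map Complex.re = 1 := by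
    ext i j; by_cases h : i = j <;> simp [Matrix.one_apply, h]
  have h2 : (1 : Matrix (Fin k) (Fin k) ℂ).map Complex.im = 0 := by
    ext i j; by_cases h : i = j <;> simp [Matrix.one_apply, h]
  simp [realify, h1, h2]

theorem realify_mul {k : ℕ} (M N : Matrix (Fin k) (Fin k) ℂ) :
    realify (M * N) = realify M * realify N := by
  have h1 : (M * N).map Complex.re
      = M.map Complex.re * N.map Complex.re - M.map Complex.im * N.map Complex.im := by
    ext i j; simp [Matrix.mul_apply, Finset.sum_sub_distrib]
  have h2 : (M * N).map Complex.im
      = M.map Complex.re * N.map Complex.im + M.map Complex.im * N.map Complex.re := by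
    ext i j; simp [Matrix.mul_apply, Finset.sum_add_distrib]
  simp only [realify, Matrix.reindex_apply, Matrix.submatrix_mul_equiv, Matrix.fromBlocks_multiply,
    h1, h2]
  congr 2
  · simp [sub_eq_add_neg]
  · simp [add_comm]
  · exact add_comm _ _
  · simp [sub_eq_add_neg, add_comm]

theorem realify_star {k : ℕ} (M : Matrix (Fin k) (Fin k) ℂ) :
    realify (star M) = star (realify M) := by
  have h1 : (star M).map Complex.re = (M.map Complex.re).transpose := by
    ext i j; simp [Matrix.star_apply]
  have h2 : (star M).map Complex.im = -(M.map Complex.im).transpose := by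
    ext i j; simp [Matrix.star_apply]
  rw [Matrix.star_eq_conjTranspose (realify M), Matrix.conjTranspose_eq_transpose_of_trivial]
  simp [realify, h1, h2, Matrix.fromBlocks_transpose]

theorem realify_continuous {k : ℕ} :
    Continuous (realify : Matrix (Fin k) (Fin k) ℂ → _) := by
  unfold realify
  simp only [Matrix.reindex_apply]
  refine Continuous.matrix_submatrix (Continuous.matrix_fromBlocks ?_ ?_ ?_ ?_) _ _
  · exact continuous_id.matrix_map Complex.continuous_re
  · exact (continuous_id.matrix_map Complex.continuous_im).neg
  · exact continuous_id.matrix_map Complex.continuous_im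
  · exact continuous_id.matrix_map Complex.continuous_re

theorem realify_ofReal {k : ℕ} (M : Matrix (Fin k) (Fin k) ℝ) :
    realify (M.map (fun x : ℝ => (x : ℂ))) = blockSum M M := by
  have h1 : (M.map (fun x : ℝ => (x : ℂ))).map Complex.re = M := by
    ext i j; simp
  have h2 : (M.map (fun x : ℝ => (x : ℂ))).map Complex.im = 0 := by
    ext i j; simp
  simp [realify, blockSum, h1, h2]

theorem ofReal_unitary {k : ℕ} (M : Matrix (Fin k) (Fin k) ℝ)
    (hM : M ∈ Matrix.orthogonalGroup (Fin k) ℝ) :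
    M.map (fun x : ℝ => (x : ℂ)) ∈ unitary (Matrix (Fin k) (Fin k) ℂ) := by
  have hs : star (M.map (fun x : ℝ => (x : ℂ))) = (star M).map (fun x : ℝ => (x : ℂ)) := by
    ext i j; simp [Matrix.star_apply]
  have h1 : (1 : Matrix (Fin k) (Fin k) ℝ).map (fun x : ℝ => (x : ℂ)) = 1 := by
    ext i j; by_cases h : i = j <;> simp [Matrix.one_apply, h]
  have hmul : ∀ P Q : Matrix (Fin k) (Fin k) ℝ, (P * Q).map (fun x : ℝ => (x : ℂ))
      = P.map (fun x : ℝ => (x : ℂ)) * Q.map (fun x : ℝ => (x : ℂ)) := by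
    intro P Q; ext i j; simp [Matrix.mul_apply]
  rw [Unitary.mem_iff, hs, ← hmul, ← hmul, (Unitary.mem_iff.1 hM).1,
    (Unitary.mem_iff.1 hM).2, h1]
  exact ⟨rfl, rfl⟩

open scoped Matrix.Norms.L2Operator in
/-- Commuting unitary tuples are joined to the identity tuple. -/
theorem unitary_path {n k : ℕ} (U : Fin n → unitary (Matrix (Fin k) (Fin k) ℂ))
    (hc : ∀ i j, Commute (U i : Matrix (Fin k) (Fin k) ℂ) (U j)) :
    ∃ g : ℝ → Fin n → Matrix (Fin k) (Fin k) ℂ, (∀ j, Continuous fun t => g t j) ∧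
      (∀ t j, g t j ∈ unitary (Matrix (Fin k) (Fin k) ℂ)) ∧
      (∀ t i j, g t i * g t j = g t j * g t i) ∧
      (∀ j, g 0 j = U j) ∧ (∀ j, g 1 j = 1) := by
  refine ⟨fun t j => (selfAdjoint.expUnitary ((1 - t) • Unitary.argSelfAdjoint (U j)) :
    unitary (Matrix (Fin k) (Fin k) ℂ)), ?_, ?_, ?_, ?_, ?_⟩
  · intro j
    exact continuous_subtype_val.comp (selfAdjoint.continuous_expUnitary.comp (by fun_prop))
  · intro t j
    exact Subtype.property _
  · intro t i j
    have h := commute_arg _ _ (hc i j)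
    have h2 : Commute
        (((1 - t) • Unitary.argSelfAdjoint (U i) : selfAdjoint (Matrix (Fin k) (Fin k) ℂ)) :
          Matrix (Fin k) (Fin k) ℂ)
        (((1 - t) • Unitary.argSelfAdjoint (U j) : selfAdjoint (Matrix (Fin k) (Fin k) ℂ)) :
          Matrix (Fin k) (Fin k) ℂ) := by
      rw [selfAdjoint.val_smul, selfAdjoint.val_smul]
      exact (h.smul_left _).smul_right _
    exact congrArg Subtype.val h2.expUnitary.eq
  · intro j
    simp only [sub_zero, one_smul]
    exact exp_arg_of_finite (U j) (Matrix.finite_spectrum _)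
  · intro j
    simp

/-- The monoid of path components of commuting tuples of orthogonal matrices under block
sum is group-like: for every commuting `n`-tuple `(A₁, …, Aₙ)` of real orthogonal `k × k`
matrices there are `k' ≥ 0` and a commuting `n`-tuple `(B₁, …, Bₙ)` of real orthogonal
`k' × k'` matrices such that `(A₁ ⊕ B₁, …, Aₙ ⊕ Bₙ)` can be joined to the identity tuple
by a path within the space `C_n(O(k + k'))` of commuting `n`-tuples of orthogonal
matrices. -/
theorem commuting_orthogonal_tuple_blockSum_joined_to_one
    (n k : ℕ) (A : Fin n → Matrix (Fin k) (Fin k) ℝ)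
    (hA : ∀ j, A j ∈ Matrix.orthogonalGroup (Fin k) ℝ)
    (hcomm : ∀ i j, A i * A j = A j * A i) :
    ∃ (k' : ℕ) (B : Fin n → Matrix (Fin k') (Fin k') ℝ),
      (∀ j, B j ∈ Matrix.orthogonalGroup (Fin k') ℝ) ∧
      (∀ i j, B i * B j = B j * B i) ∧
      JoinedIn {g : Fin n → Matrix (Fin (k + k')) (Fin (k + k')) ℝ |
          (∀ j, g j ∈ Matrix.orthogonalGroup (Fin (k + k')) ℝ) ∧
          ∀ i j, g i * g j = g j * g i}
        (fun j => blockSum (A j) (B j)) (fun _ => 1) := by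
  have hc : ∀ i j, Commute ((A i).map (fun x : ℝ => (x : ℂ))) ((A j).map (fun x : ℝ => (x : ℂ))) := by
    intro i j
    have h := congrArg (fun M : Matrix (Fin k) (Fin k) ℝ => M.map Complex.ofRealHom) (hcomm i j)
    simp only [Matrix.map_mul] at h
    exact h
  obtain ⟨g, hg, hu, hgc, h0, h1⟩ :=
    unitary_path (fun j => ⟨(A j).map (fun x : ℝ => (x : ℂ)), ofReal_unitary _ (hA j)⟩) hc
  refine ⟨k, A, hA, hcomm, ?_⟩
  refine JoinedIn.ofLine (f := fun t j => realify (g t j)) ?_ ?_ ?_ ?_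
  · exact (continuous_pi fun j => realify_continuous.comp (hg j)).continuousOn
  · funext j
    simp only [h0, realify_ofReal]
  · funext j
    simp only [h1, realify_one]
  · rintro _ ⟨t, -, rfl⟩
    refine ⟨fun j => ?_, fun i j => ?_⟩
    · change realify (g t j) ∈ _
      rw [Matrix.mem_orthogonalGroup_iff, ← Matrix.conjTranspose_eq_transpose_of_trivial,
        ← Matrix.star_eq_conjTranspose, ← realify_star, ← realify_mul,
        (Unitary.mem_iff.1 (hu t j)).2, realify_one]
    · rw [← realify_mul, ← realify_mul, hgc]
end

section
/- Fix n, m ≥ 1. Let T = (S¹)ⁿ be the n-torus, where S¹ is the unit circle in ℂ. For z ∈ S¹ let R(z) ∈ O(2) denote the rotation matrix with first column (Re z, Im z) and second column (−Im z, Re z). Consider the continuous map T^m → C_n(O(2m+1)) sending an m-tuple (λ_1, …, λ_m) of points λ_i = (λ_i^{(1)},…,λ_i^{(n)}) ∈ T to the commuting n-tuple (A_1,…,A_n), where A_j is the block-diagonal orthogonal matrix with blocks R(λ_1^{(j)}), …, R(λ_m^{(j)}) followed by the 1×1 block (1). This map descends to a homeomorphism from the quotient of T^m by the wreath product C_2 ≀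 Σ_m — where Σ_m permutes the m coordinates and each C_2 factor acts on the corresponding copy of T by entrywise complex conjugation — onto the path component of the trivial tuple (I,…,I) in Rep_n(O(2m+1)). -/
/-- The space `C_n(G)` of commuting `n`-tuples in a topological group `G`, topologized as
a subspace of `Gⁿ`. -/
def CommTuples (n : ℕ) (G : Type*) [Group G] : Type _ :=
  {g : Fin n → G // ∀ i j, g i * g j = g j * g i}

instance (n : ℕ) (G : Type*) [Group G] [TopologicalSpace G] :
    TopologicalSpace (CommTuples n G) :=
  inferInstanceAs (TopologicalSpace {g : Fin n → G // ∀ i j, g i * g j = g j * g i})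

/-- The conjugacy relation on commuting tuples: `y` is the (diagonal) conjugate of `x` by
some `g ∈ G`. -/
def repRel (n : ℕ) (G : Type*) [Group G] (x y : CommTuples n G) : Prop :=
  ∃ g : G, ∀ i, y.1 i = g * x.1 i * g⁻¹

/-- The representation space `Rep_n(G) = C_n(G)/G`, the quotient of `C_n(G)` by the
conjugation action of `G`, with the quotient topology. -/
def RepSpace (n : ℕ) (G : Type*) [Group G] [TopologicalSpace G] : Type _ :=
  Quot (repRel n G)

instance (n : ℕ) (G : Type*) [Group G] [TopologicalSpace G] :
    TopologicalSpace (RepSpace n G) :=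
  inferInstanceAs (TopologicalSpace (Quot (repRel n G)))

/-- The trivial commuting tuple `(1, …, 1)`. -/
def oneTuple (n : ℕ) (G : Type*) [Group G] : CommTuples n G :=
  ⟨fun _ => 1, fun _ _ => rfl⟩

/-- The rotation matrix `R(z) ∈ O(2)` attached to `z ∈ ℂ`, with first column
`(Re z, Im z)` and second column `(−Im z, Re z)`. -/
noncomputable def rot (z : ℂ) : Matrix (Fin 2) (Fin 2) ℝ :=
  !![z.re, -z.im; z.im, z.re]

/-- Reindexing equivalence identifying the index set of the block matrix
(`m` blocks of size `2` plus one block of size `1`) with `Fin (2m+1)`. -/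
def blockIndexEquiv (m : ℕ) : (Fin 2 × Fin m) ⊕ Fin 1 ≃ Fin (2 * m + 1) :=
  (Equiv.sumCongr finProdFinEquiv (Equiv.refl (Fin 1))).trans finSumFinEquiv

/-- The block-diagonal `(2m+1) × (2m+1)` real matrix with diagonal blocks
`R(z₁), …, R(z_m)` followed by the `1 × 1` block `(1)`. -/
noncomputable def bigMat (m : ℕ) (z : Fin m → ℂ) :
    Matrix (Fin (2 * m + 1)) (Fin (2 * m + 1)) ℝ :=
  Matrix.reindex (blockIndexEquiv m) (blockIndexEquiv m)
    (Matrix.fromBlocks (Matrix.blockDiagonal fun i => rot (z i)) 0 0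
      (1 : Matrix (Fin 1) (Fin 1) ℝ))

/-- The relation on `T^m` (with `T = (S¹)ⁿ` the `n`-torus) identifying two `m`-tuples in
the same orbit of the wreath product `C₂ ≀ Σ_m`, which acts by permuting the `m`
coordinates (`Σ_m`) and by entrywise complex conjugation in single factors (each `C₂`). -/
def wreathRel (n m : ℕ) (a b : Fin m → Fin n → Circle) : Prop :=
  ∃ (σ : Equiv.Perm (Fin m)) (ε : Fin m → Bool), ∀ i j,
    (b i j : ℂ) = if ε i then (starRingEnd ℂ) (a (σ i) j : ℂ) else (a (σ i) j : ℂ)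


namespace WR
open Matrix

/-- General block matrix. -/
noncomputable def D {κ ι : Type} [DecidableEq κ] [DecidableEq ι] (z : κ → ℂ) (c : ι → ℝ) :
    Matrix ((Fin 2 × κ) ⊕ ι) ((Fin 2 × κ) ⊕ ι) ℝ :=
  fromBlocks (blockDiagonal fun i => rot (z i)) 0 0 (diagonal c)

lemma rot_mul (z w : ℂ) : rot (z * w) = rot z * rot w := by
  ext i j; fin_cases i <;> fin_cases j <;> simp [rot, Matrix.mul_apply, Fin.sum_univ_two] <;> ring

lemma rot_one : rot 1 = 1 := by
  ext i j; fin_cases i <;> fin_cases j <;> simp [rot]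

lemma rot_transpose (z : ℂ) : (rot z)ᵀ = rot ((starRingEnd ℂ) z) := by
  ext i j; fin_cases i <;> fin_cases j <;> simp [rot]

section
variable {κ ι : Type} [DecidableEq κ] [DecidableEq ι] [Fintype κ] [Fintype ι]

lemma D_one : D (1 : κ → ℂ) (1 : ι → ℝ) = 1 := by
  have : (fun i : κ => rot ((1 : κ → ℂ) i)) = 1 := by
    funext i; simp [rot_one]
  have h2 : diagonal (1 : ι → ℝ) = 1 := diagonal_one
  rw [D, this, h2, blockDiagonal_one, fromBlocks_one]

lemma D_mul (z w : κ → ℂ) (c d : ι → ℝ) : D (z * w) (c * d) = D z c * D w d := by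
  simp only [D, fromBlocks_multiply]
  congr 1
  · simp [rot_mul, blockDiagonal_mul]
  · simp
  · simp
  · simp [diagonal_mul_diagonal]

lemma D_trace (z : κ → ℂ) (c : ι → ℝ) :
    (((D z c).trace : ℝ) : ℂ) = ∑ i, (z i + (starRingEnd ℂ) (z i)) + ∑ x, (c x : ℂ) := by
  simp only [Matrix.trace, Fintype.sum_sum_type, Fintype.sum_prod_type, Fin.sum_univ_two]
  simp [D, rot, Complex.add_conj, blockDiagonal_apply]
  rw [← Finset.mul_sum]; ring

lemma D_transpose_mul (z : κ → Circle) : (D (fun i => (z i : ℂ)) (1 : ι → ℝ))ᵀ * D (fun i => (z i : ℂ)) (1 : ι → ℝ) = 1 := by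
  have : (D (fun i => (z i : ℂ)) (1 : ι → ℝ))ᵀ = D (fun i => (starRingEnd ℂ) (z i : ℂ)) (1 : ι → ℝ) := by
    simp [D, fromBlocks_transpose, rot_transpose]
  rw [this, ← D_mul, ← D_one]
  congr 1
  · funext i; simp [← Circle.coe_inv_eq_conj]
  · simp

lemma D_comm (z w : κ → ℂ) (c d : ι → ℝ) : D z c * D w d = D w d * D z c := by
  rw [← D_mul, ← D_mul, mul_comm z, mul_comm c]
end

/-- word characters -/
noncomputable abbrev wd {n : ℕ} (c : Fin n → ℂ) : FreeMonoid (Fin n) →* ℂ := FreeMonoid.lift c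

lemma wd_injective {n : ℕ} : Function.Injective (wd (n := n)) := (FreeMonoid.lift).injective

lemma multiset_eq {n : ℕ} (s t : Multiset (Fin n → ℂ))
    (h : ∀ w, (s.map (fun c => wd c w)).sum = (t.map (fun c => wd c w)).sum) : s = t := by
  classical
  have li := linearIndependent_monoidHom (FreeMonoid (Fin n)) ℂ
  have li2 := li.comp wd wd_injective
  rw [linearIndependent_iff_injective_finsuppLinearCombination] at li2
  have key : ∀ u : Multiset (Fin n → ℂ), ∀ w,
      (Finsupp.linearCombination ℂ ((fun f => f : (FreeMonoid (Fin n) →* ℂ) → FreeMonoid (Fin n) → ℂ) ∘ wd)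
        (u.map (fun c => Finsupp.single c (1:ℂ))).sum) w = (u.map (fun c => wd c w)).sum := by
    intro u w
    induction u using Multiset.induction_on with
    | empty => simp
    | cons a u ih =>
      simp only [Multiset.map_cons, Multiset.sum_cons, map_add, Pi.add_apply, ih]
      simp
  have e : (s.map (fun c => Finsupp.single c (1:ℂ))).sum = (t.map (fun c => Finsupp.single c (1:ℂ))).sum := by
    apply li2
    funext w
    rw [key, key, h]
  have cnt : ∀ u : Multiset (Fin n → ℂ), ∀ c, (u.map (fun c => Finsupp.single c (1:ℂ))).sum c = u.count c := by
    intro u c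
    induction u using Multiset.induction_on with
    | empty => simp
    | cons a u ih =>
      simp only [Multiset.map_cons, Multiset.sum_cons, Finsupp.add_apply, ih, Multiset.count_cons,
        Finsupp.single_apply]
      by_cases hc : a = c
      · subst hc; simp [add_comm]
      · simp [hc, Ne.symm hc]
  ext c
  have := congrArg (fun f => f c) e
  simp only [cnt] at this
  exact_mod_cast this

section
variable {κ ι : Type} [DecidableEq κ] [DecidableEq ι] [Fintype κ] [Fintype ι] {n N : ℕ}

lemma word_D (z : κ → Fin n → ℂ) (c : ι → Fin n → ℝ) (P : Matrix (Fin N) ((Fin 2 × κ) ⊕ ι) ℝ)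
    (h1 : Pᵀ * P = 1) (h2 : P * Pᵀ = 1) (A : Fin n → Matrix (Fin N) (Fin N) ℝ)
    (hA : ∀ j, A j = P * D (fun i => z i j) (fun x => c x j) * Pᵀ) (w : FreeMonoid (Fin n)) :
    FreeMonoid.lift A w =
      P * D (fun i => FreeMonoid.lift (z i) w) (fun x => FreeMonoid.lift (c x) w) * Pᵀ := by
  induction w using FreeMonoid.inductionOn' with
  | one =>
    have : D (fun i => FreeMonoid.lift (z i) 1) (fun x => FreeMonoid.lift (c x) 1) = 1 := by
      rw [← D_one]; congr 1
    rw [this]; simp [h2]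
  | of_mul a w ih =>
    have : D (fun i => FreeMonoid.lift (z i) (FreeMonoid.of a * w)) (fun x => FreeMonoid.lift (c x) (FreeMonoid.of a * w)) =
      D (fun i => z i a) (fun x => c x a) * D (fun i => FreeMonoid.lift (z i) w) (fun x => FreeMonoid.lift (c x) w) := by
      rw [← D_mul]; congr 1 <;> funext i <;> simp
    rw [this, map_mul, ih, FreeMonoid.lift_eval_of, hA]
    simp only [Matrix.mul_assoc]
    rw [← Matrix.mul_assoc Pᵀ P, h1, Matrix.one_mul]

/-- multiset of characters -/
noncomputable def chars (z : κ → Fin n → ℂ) (c : ι → Fin n → ℝ) : Multiset (Fin n → ℂ) :=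
  (Finset.univ.val.map z + Finset.univ.val.map (fun i j => (starRingEnd ℂ) (z i j)))
    + Finset.univ.val.map (fun x j => (c x j : ℂ))

lemma trace_word (z : κ → Fin n → ℂ) (c : ι → Fin n → ℝ) (P : Matrix (Fin N) ((Fin 2 × κ) ⊕ ι) ℝ)
    (h1 : Pᵀ * P = 1) (h2 : P * Pᵀ = 1) (A : Fin n → Matrix (Fin N) (Fin N) ℝ)
    (hA : ∀ j, A j = P * D (fun i => z i j) (fun x => c x j) * Pᵀ) (w : FreeMonoid (Fin n)) :
    (((FreeMonoid.lift A w).trace : ℝ) : ℂ) = ((chars z c).map (fun c => wd c w)).sum := by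
  rw [word_D z c P h1 h2 A hA, Matrix.mul_assoc, trace_mul_comm, Matrix.mul_assoc, h1, Matrix.mul_one, D_trace]
  have e1 : ∀ i, (starRingEnd ℂ) (FreeMonoid.lift (z i) w) = wd (fun j => (starRingEnd ℂ) (z i j)) w := by
    intro i
    induction w using FreeMonoid.inductionOn' with
    | one => simp
    | of_mul a w ih => rw [map_mul, map_mul, map_mul, ih]; simp
  have e2 : ∀ x, ((FreeMonoid.lift (c x) w : ℝ) : ℂ) = wd (fun j => (c x j : ℂ)) w := by
    intro i
    clear e1
    induction w using FreeMonoid.inductionOn' with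
    | one => simp
    | of_mul a w ih => rw [map_mul, map_mul, ← ih]; simp
  simp only [e1, e2, chars, Multiset.map_add, Multiset.sum_add, Multiset.map_map, Finset.sum_add_distrib]
  rfl

end
end WR

namespace WR
open Matrix

lemma perm_of_map_eq {α β : Type*} [Fintype α] (f g : α → β)
    (h : Finset.univ.val.map f = Finset.univ.val.map g) : ∃ σ : Equiv.Perm α, ∀ a, g (σ a) = f a := by
  classical
  have key : ∀ c, Nonempty ({a // f a = c} ≃ {a // g a = c}) := by
    intro c
    apply Fintype.card_eq.mp
    have := congrArg (Multiset.count c) h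
    rw [Multiset.count_map, Multiset.count_map] at this
    rw [Fintype.card_subtype, Fintype.card_subtype]
    simp only [Finset.card_def, Finset.filter_val]
    simpa [eq_comm] using this
  exact ⟨Equiv.ofFiberEquiv (fun c => (key c).some), fun a => Equiv.ofFiberEquiv_map _ a⟩

/-- entrywise conjugation -/
noncomputable def cj {n : ℕ} (c : Fin n → ℂ) : Fin n → ℂ := fun j => (starRingEnd ℂ) (c j)

lemma cj_cj {n : ℕ} (c : Fin n → ℂ) : cj (cj c) = c := by funext j; simp [cj]

lemma chars_wreath {n m : ℕ} (a b : Fin m → Fin n → Circle)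
    (h : chars (fun i j => (a i j : ℂ)) (fun (_ : Fin 1) _ => (1:ℝ)) =
      chars (fun i j => (b i j : ℂ)) (fun (_ : Fin 1) _ => (1:ℝ))) : wreathRel n m a b := by
  classical
  have h' := add_right_cancel h
  have h2 := congrArg (Multiset.map (fun c => s(c, cj c))) h'
  simp only [Multiset.map_add, Multiset.map_map] at h2
  have e : ∀ u : Fin m → Fin n → Circle, ((fun c : Fin n → ℂ => s(c, cj c)) ∘ fun i j => (starRingEnd ℂ) (u i j : ℂ)) =
     ((fun c => s(c, cj c)) ∘ fun i j => (u i j : ℂ)) := by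
    intro u; funext i
    simp only [Function.comp]
    have : (fun j => (starRingEnd ℂ) (u i j : ℂ)) = cj (fun j => (u i j : ℂ)) := rfl
    rw [this, cj_cj, Sym2.eq_swap]
  rw [e, e, ← two_nsmul, ← two_nsmul] at h2
  have h3 : ∀ s t : Multiset (Sym2 (Fin n → ℂ)), 2 • s = 2 • t → s = t := by
    intro s t hst
    ext x
    have := congrArg (Multiset.count x) hst
    simpa [Multiset.count_nsmul] using this
  obtain ⟨σ, hσ⟩ := perm_of_map_eq _ _ (h3 _ _ h2.symm)
  refine ⟨σ, fun i => decide (¬ ∀ j, (b i j : ℂ) = a (σ i) j), fun i j => ?_⟩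
  have := hσ i
  simp only [Function.comp, Sym2.eq_iff] at this
  by_cases hb : ∀ j, (b i j : ℂ) = a (σ i) j
  · simp [hb]
  · simp only [hb, not_false_eq_true, decide_true, if_true]
    rcases this with ⟨h1, -⟩ | ⟨-, h1⟩
    · exact absurd (fun j => (congrFun h1 j).symm) hb
    · exact (congrFun h1 j).symm

lemma count_even {κ : Type} [Fintype κ] {n : ℕ} (z : κ → Fin n → ℂ) (c : Fin n → ℂ) (hc : cj c = c) [DecidableEq (Fin n → ℂ)] :
    Even (Multiset.count c (Finset.univ.val.map z + Finset.univ.val.map (fun i j => (starRingEnd ℂ) (z i j)))) := by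
  have : (fun i j => (starRingEnd ℂ) (z i j)) = cj ∘ z := rfl
  rw [this, ← Multiset.map_map, Multiset.count_add]
  have hinj : Function.Injective (cj (n := n)) := fun x y h => by rw [← cj_cj x, h, cj_cj]
  have := Multiset.count_map_eq_count' cj (Finset.univ.val.map z) hinj c
  rw [hc] at this
  rw [this]
  exact ⟨_, rfl⟩

lemma chars_X {κ κ' : Type} [Fintype κ] [Fintype κ'] [DecidableEq κ] [DecidableEq κ'] {n : ℕ} (z : κ → Fin n → ℂ) (z' : κ' → Fin n → ℂ)
    (X : Finset (Fin n → ℤˣ))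
    (h : chars z (fun (_ : Fin 1) _ => (1:ℝ)) = chars z' (fun (x : X) j => (((x.1 j : ℤˣ) : ℤ) : ℝ))) : X = {1} := by
  classical
  let f : (Fin n → ℤˣ) → Fin n → ℂ := fun x j => (((x j : ℤˣ) : ℤ) : ℂ)
  have hf : Function.Injective f := by
    intro x y hxy; funext j
    have := congrFun hxy j
    simp only [f] at this
    exact Units.ext (by exact_mod_cast this)
  have hX : Finset.univ.val.map (fun (x : X) j => (((((x.1 j : ℤˣ) : ℤ) : ℝ)) : ℂ)) = X.val.map f := by
    have : (fun (x : X) j => (((((x.1 j : ℤˣ) : ℤ) : ℝ)) : ℂ)) = f ∘ (fun x : X => x.1) := by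
      funext x j; simp [f]
    rw [this, ← Multiset.map_map]
    congr 1
    exact congrArg Finset.val X.attach_map_val
  have h1 : (Finset.univ.val.map (fun (_ : Fin 1) (_ : Fin n) => ((1:ℝ) : ℂ))) = ({1} : Finset (Fin n → ℤˣ)).val.map f := by
    simp [f]
  ext x
  have hc : cj (f x) = f x := by funext j; simp [cj, f]
  have e1 := count_even z (f x) hc
  have e2 := count_even z' (f x) hc
  have hh := congrArg (Multiset.count (f x)) h
  simp only [chars] at hh
  rw [Multiset.count_add, Multiset.count_add _ (_ + _), h1, hX, Multiset.count_map_eq_count' f _ hf, Multiset.count_map_eq_count' f _ hf] at hh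
  have n1 : Multiset.count x X.val = if x ∈ X then 1 else 0 := by
    split_ifs with hx
    · exact Multiset.count_eq_one_of_mem X.nodup hx
    · exact Multiset.count_eq_zero_of_notMem hx
  have n2 : Multiset.count x ({1} : Finset (Fin n → ℤˣ)).val = if x ∈ ({1} : Finset (Fin n → ℤˣ)) then 1 else 0 := by
    split_ifs with hx
    · exact Multiset.count_eq_one_of_mem (Finset.nodup _) hx
    · exact Multiset.count_eq_zero_of_notMem hx
  rw [n1, n2] at hh
  obtain ⟨p, hp⟩ := e1
  obtain ⟨q, hq⟩ := e2
  rw [hp, hq] at hh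
  split_ifs at hh with a1 a2 a2
  · exact ⟨fun _ => a1, fun _ => a2⟩
  · omega
  · omega
  · exact ⟨fun _ => absurd ‹_› a2, fun _ => absurd ‹_› a1⟩

end WR

namespace WR
open Matrix

lemma common_eig {n N : ℕ} (U : Submodule ℂ (Fin N → ℂ)) (hU : U ≠ ⊥)
    (f : Fin n → Module.End ℂ (Fin N → ℂ)) (hc : ∀ i j, f i * f j = f j * f i)
    (hf : ∀ j, ∀ z ∈ U, f j z ∈ U) : ∃ z ∈ U, z ≠ 0 ∧ ∃ l : Fin n → ℂ, ∀ j, f j z = l j • z := by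
  classical
  have key : ∀ s : Finset (Fin n), ∃ W : Submodule ℂ (Fin N → ℂ), W ≤ U ∧ W ≠ ⊥ ∧
      (∀ j, ∀ z ∈ W, f j z ∈ W) ∧ ∀ j ∈ s, ∃ l : ℂ, ∀ z ∈ W, f j z = l • z := by
    intro s
    induction s using Finset.induction_on with
    | empty => exact ⟨U, le_rfl, hU, hf, by simp⟩
    | insert a s ha ih =>
      obtain ⟨W, hWU, hW, hinv, hs⟩ := ih
      have : Nontrivial W := Submodule.nontrivial_iff_ne_bot.mpr hW
      obtain ⟨l, hl⟩ := Module.End.exists_eigenvalue ((f a).restrict (hinv a))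
      obtain ⟨v, hv⟩ := hl.exists_hasEigenvector
      refine ⟨W ⊓ Module.End.eigenspace (f a) l, inf_le_left.trans hWU, ?_, ?_, ?_⟩
      · intro hbot
        have hv1 : (v : Fin N → ℂ) ∈ W ⊓ Module.End.eigenspace (f a) l := by
          refine ⟨v.2, ?_⟩
          refine Module.End.mem_eigenspace_iff.mpr ?_
          have := congrArg Subtype.val hv.apply_eq_smul
          simpa using this
        rw [hbot, Submodule.mem_bot] at hv1
        exact hv.2 (Subtype.ext hv1)
      · rintro j z ⟨hz1, hz2⟩
        refine ⟨hinv j z hz1, ?_⟩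
        have hz2' : f a z = l • z := Module.End.mem_eigenspace_iff.mp hz2
        have := congrArg (fun g : Module.End ℂ (Fin N → ℂ) => g z) (hc a j)
        simp only [Module.End.mul_apply] at this
        exact Module.End.mem_eigenspace_iff.mpr (by rw [this, hz2', map_smul])
      · intro j hj
        rcases Finset.mem_insert.mp hj with rfl | hj
        · exact ⟨l, fun z hz => Module.End.mem_eigenspace_iff.mp hz.2⟩
        · obtain ⟨l', h'⟩ := hs j hj
          exact ⟨l', fun z hz => h' z hz.1⟩
  obtain ⟨W, hWU, hW, -, hs⟩ := key Finset.univ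
  obtain ⟨z, hz, hz0⟩ := W.ne_bot_iff.mp hW
  choose l hl using fun j => hs j (Finset.mem_univ j)
  exact ⟨z, hWU hz, hz0, l, fun j => hl j z hz⟩

lemma mapC_re {a b : Type*} [Fintype b] (M : Matrix a b ℝ) (z : b → ℂ) (i : a) :
    ((M.map Complex.ofReal *ᵥ z) i).re = (M *ᵥ (fun j => (z j).re)) i := by
  simp [mulVec, dotProduct]

lemma mapC_im {a b : Type*} [Fintype b] (M : Matrix a b ℝ) (z : b → ℂ) (i : a) :
    ((M.map Complex.ofReal *ᵥ z) i).im = (M *ᵥ (fun j => (z j).im)) i := by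
  simp [mulVec, dotProduct]

section
variable {κ ι : Type} [DecidableEq κ] [DecidableEq ι] [Fintype κ] [Fintype ι] {n N : ℕ}

lemma D_transpose (z : κ → ℂ) (c : ι → ℝ) : (D z c)ᵀ = D (fun i => (starRingEnd ℂ) (z i)) c := by
  simp [D, fromBlocks_transpose, rot_transpose]

lemma D_orth (z : κ → Circle) (c : ι → ℤˣ) :
    D (fun i => (z i : ℂ)) (fun x => ((c x : ℤ) : ℝ)) *
     (D (fun i => (z i : ℂ)) (fun x => ((c x : ℤ) : ℝ)))ᵀ = 1 := by
  rw [D_transpose, ← D_mul, ← D_one]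
  congr 1
  · funext i; simp [← Circle.coe_inv_eq_conj]
  · funext x; rcases Int.units_eq_one_or (c x) with h | h <;> simp [h]

/-- A compatible orthonormal system. -/
structure Sys (A : Fin n → Matrix (Fin N) (Fin N) ℝ) (v : (Fin 2 × κ) ⊕ ι → Fin N → ℝ)
    (μ : κ → Fin n → Circle) (χ : ι → Fin n → ℤˣ) : Prop where
  orth : ∀ i i', v i ⬝ᵥ v i' = if i = i' then 1 else 0
  h0 : ∀ j i, A j *ᵥ v (.inl (0, i)) = (μ i j : ℂ).re • v (.inl (0, i)) + (μ i j : ℂ).im • v (.inl (1, i))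
  h1 : ∀ j i, A j *ᵥ v (.inl (1, i)) = -(μ i j : ℂ).im • v (.inl (0, i)) + (μ i j : ℂ).re • v (.inl (1, i))
  hr : ∀ j x, A j *ᵥ v (.inr x) = ((χ x j : ℤ) : ℝ) • v (.inr x)

lemma Sys.gram {A : Fin n → Matrix (Fin N) (Fin N) ℝ} {v : (Fin 2 × κ) ⊕ ι → Fin N → ℝ}
    {μ : κ → Fin n → Circle} {χ : ι → Fin n → ℤˣ} (S : Sys A v μ χ) : of v * (of v)ᵀ = 1 := by
  ext i i'
  simpa [Matrix.mul_apply, dotProduct, Matrix.one_apply] using S.orth i i'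

lemma Sys.act {A : Fin n → Matrix (Fin N) (Fin N) ℝ} {v : (Fin 2 × κ) ⊕ ι → Fin N → ℝ}
    {μ : κ → Fin n → Circle} {χ : ι → Fin n → ℤˣ} (S : Sys A v μ χ) (j : Fin n) :
    A j * (of v)ᵀ = (of v)ᵀ * D (fun i => (μ i j : ℂ)) (fun x => ((χ x j : ℤ) : ℝ)) := by
  ext a i
  rw [Matrix.mul_apply, Matrix.mul_apply]
  simp only [Fintype.sum_sum_type, Fintype.sum_prod_type, Fin.sum_univ_two]
  rcases i with ⟨t, i⟩ | x
  · fin_cases t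
    · have := congrFun (S.h0 j i) a
      simp only [mulVec, dotProduct] at this
      simp [this, D, rot, blockDiagonal_apply, mul_comm]
    · have := congrFun (S.h1 j i) a
      simp only [mulVec, dotProduct] at this
      simp [this, D, rot, blockDiagonal_apply, mul_comm]
  · have := congrFun (S.hr j x) a
    simp only [mulVec, dotProduct] at this
    simp [this, D, diagonal_apply, mul_comm]

lemma Sys.card_le {A : Fin n → Matrix (Fin N) (Fin N) ℝ} {v : (Fin 2 × κ) ⊕ ι → Fin N → ℝ}
    {μ : κ → Fin n → Circle} {χ : ι → Fin n → ℤˣ} (S : Sys A v μ χ) :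
    2 * Fintype.card κ + Fintype.card ι ≤ N := by
  have h := S.gram
  have h1 := Matrix.rank_mul_le_left (of v) (of v)ᵀ
  rw [h, Matrix.rank_one] at h1
  have h2 := Matrix.rank_le_card_width (of v)
  rw [Fintype.card_fin] at h2
  simp only [Fintype.card_sum, Fintype.card_prod, Fintype.card_fin] at h1
  omega

lemma Sys.piece {A : Fin n → Matrix (Fin N) (Fin N) ℝ} {v : (Fin 2 × κ) ⊕ ι → Fin N → ℝ}
    {μ : κ → Fin n → Circle} {χ : ι → Fin n → ℤˣ} (S : Sys A v μ χ)
    (hA : ∀ j, (A j)ᵀ * A j = 1) (hc : ∀ i j, A i * A j = A j * A i)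
    (hlt : 2 * Fintype.card κ + Fintype.card ι < N) :
    ∃ (x y : Fin N → ℝ) (l : Fin n → ℂ), (x ≠ 0 ∨ y ≠ 0) ∧ (∀ i, v i ⬝ᵥ x = 0) ∧ (∀ i, v i ⬝ᵥ y = 0) ∧
      (∀ j, A j *ᵥ x = (l j).re • x - (l j).im • y) ∧ (∀ j, A j *ᵥ y = (l j).im • x + (l j).re • y) := by
  let M := (of v).map Complex.ofReal
  have hmul : ∀ {a b c : Type} [Fintype b] (P : Matrix a b ℝ) (Q : Matrix b c ℝ),
      (P * Q).map Complex.ofReal = P.map Complex.ofReal * Q.map Complex.ofReal := by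
    intro a b c _ P Q
    exact Matrix.map_mul (f := Complex.ofRealHom)
  have hker : LinearMap.ker M.mulVecLin ≠ ⊥ := by
    apply LinearMap.ker_ne_bot_of_finrank_lt
    simp only [Module.finrank_fintype_fun_eq_card, Fintype.card_sum, Fintype.card_prod, Fintype.card_fin]
    omega
  have hid : ∀ j, D (fun i => (μ i j : ℂ)) (fun x => ((χ x j : ℤ) : ℝ)) * of v = of v * A j := by
    intro j
    have h := congrArg Matrix.transpose (S.act j)
    rw [transpose_mul, transpose_mul, transpose_transpose] at h
    have h2 : of v = (D (fun i => (μ i j : ℂ)) (fun x => ((χ x j : ℤ) : ℝ)))ᵀ * (of v * A j) := by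
      rw [← Matrix.mul_assoc, ← h, Matrix.mul_assoc, hA, Matrix.mul_one]
    conv_lhs => rw [h2]
    rw [← Matrix.mul_assoc, D_orth, Matrix.one_mul]
  obtain ⟨z, hz, hz0, l, hl⟩ := common_eig (LinearMap.ker M.mulVecLin) hker
    (fun j => ((A j).map Complex.ofReal).mulVecLin)
    (by intro i j
        rw [Module.End.mul_eq_comp, Module.End.mul_eq_comp, ← Matrix.mulVecLin_mul, ← Matrix.mulVecLin_mul, ← hmul, hc, hmul])
    (by
      intro j z hz
      rw [LinearMap.mem_ker, Matrix.mulVecLin_apply] at hz ⊢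
      rw [Matrix.mulVecLin_apply, Matrix.mulVec_mulVec, ← hmul, ← hid, hmul, ← Matrix.mulVec_mulVec, hz,
        Matrix.mulVec_zero])
  rw [LinearMap.mem_ker] at hz
  simp only [Matrix.mulVecLin_apply] at hz hl
  refine ⟨fun a => (z a).re, fun a => (z a).im, l, ?_, ?_, ?_, ?_, ?_⟩
  · by_contra hcon
    push Not at hcon
    apply hz0
    funext a
    exact Complex.ext (congrFun hcon.1 a) (congrFun hcon.2 a)
  · intro i
    have := mapC_re (of v) z i
    rw [hz] at this
    exact this.symm
  · intro i
    have := mapC_im (of v) z i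
    rw [hz] at this
    exact this.symm
  · intro j; funext a
    rw [← mapC_re, hl]; simp
  · intro j; funext a
    rw [← mapC_im, hl]; simp; ring

end
end WR

namespace WR
open Matrix

section
variable {κ ι : Type} [DecidableEq κ] [DecidableEq ι] [Fintype κ] [Fintype ι] {n N : ℕ}
  {A : Fin n → Matrix (Fin N) (Fin N) ℝ} {v : (Fin 2 × κ) ⊕ ι → Fin N → ℝ}
    {μ : κ → Fin n → Circle} {χ : ι → Fin n → ℤˣ}

lemma Sys.extend_real (S : Sys A v μ χ) (w : Fin N → ℝ) (c : Fin n → ℤˣ) (hw : w ⬝ᵥ w = 1)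
    (hv : ∀ i, v i ⬝ᵥ w = 0) (hc : ∀ j, A j *ᵥ w = ((c j : ℤ) : ℝ) • w) :
    Sys A (κ := κ) (ι := Option ι)
      (Sum.elim (fun p => v (.inl p)) (fun o => o.elim w (fun x => v (.inr x)))) μ
      (fun o => o.elim c χ) := by
  have hv' : ∀ i, w ⬝ᵥ v i = 0 := fun i => by rw [dotProduct_comm]; exact hv i
  refine ⟨?_, ?_, ?_, ?_⟩
  · rintro (p | (_ | x)) (p' | (_ | x')) <;> simp [hw, hv, hv', S.orth]
  · intro j i; exact S.h0 j i
  · intro j i; exact S.h1 j i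
  · rintro j (_ | x)
    · exact hc j
    · exact S.hr j x

lemma Sys.extend_plane (S : Sys A v μ χ) (x y : Fin N → ℝ) (c : Fin n → Circle) (hx : x ⬝ᵥ x = 1)
    (hy : y ⬝ᵥ y = 1) (hxy : x ⬝ᵥ y = 0)
    (hvx : ∀ i, v i ⬝ᵥ x = 0) (hvy : ∀ i, v i ⬝ᵥ y = 0)
    (hcx : ∀ j, A j *ᵥ x = (c j : ℂ).re • x + (c j : ℂ).im • y)
    (hcy : ∀ j, A j *ᵥ y = -(c j : ℂ).im • x + (c j : ℂ).re • y) :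
    Sys A (κ := Option κ) (ι := ι)
      (Sum.elim (fun p => p.2.elim (if p.1 = 0 then x else y) (fun i => v (.inl (p.1, i))))
        (fun o => v (.inr o))) (fun o => o.elim c μ) χ := by
  have hvx' : ∀ i, x ⬝ᵥ v i = 0 := fun i => by rw [dotProduct_comm]; exact hvx i
  have hvy' : ∀ i, y ⬝ᵥ v i = 0 := fun i => by rw [dotProduct_comm]; exact hvy i
  have hyx : y ⬝ᵥ x = 0 := by rw [dotProduct_comm]; exact hxy
  refine ⟨?_, ?_, ?_, ?_⟩
  · rintro (⟨t, (_ | i)⟩ | x) (⟨t', (_ | i')⟩ | x')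
    · fin_cases t <;> fin_cases t' <;> simp [*]
    all_goals
      first
      | (simp [S.orth]; done)
      | (fin_cases t <;> simp [*]; done)
      | (fin_cases t' <;> simp [*]; done)
  · rintro j (_ | i)
    · simpa using hcx j
    · exact S.h0 j i
  · rintro j (_ | i)
    · simpa using hcy j
    · exact S.h1 j i
  · intro j x; exact S.hr j x

lemma Sys.merge (S : Sys A v μ χ) (a b : ι) (hab : a ≠ b) (h : χ a = χ b) :
    ∃ v', Sys A (κ := Option κ) (ι := {x // x ≠ a ∧ x ≠ b}) v'
      (fun o => o.elim (fun j => if χ a j = 1 then 1 else Circle.exp Real.pi) μ) (fun x => χ x.1) := by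
  let e : (Fin 2 × Option κ) ⊕ {x // x ≠ a ∧ x ≠ b} → (Fin 2 × κ) ⊕ ι :=
    Sum.elim (fun p => p.2.elim (.inr (if p.1 = 0 then a else b)) (fun i => (.inl (p.1, i))))
        (fun o => (.inr o.1))
  have he : Function.Injective e := by
    rintro (⟨t, (_ | i)⟩ | ⟨x, hx1, hx2⟩) (⟨t', (_ | i')⟩ | ⟨x', hx1', hx2'⟩) hh
    · fin_cases t <;> fin_cases t' <;> simp_all [e, eq_comm]
    all_goals
      simp only [e, Sum.elim_inl, Sum.elim_inr, Option.elim] at hh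
      grind
  refine ⟨v ∘ e, ⟨?_, ?_, ?_, ?_⟩⟩
  · intro i i'
    simp only [Function.comp, S.orth, he.eq_iff]
  · rintro j (_ | i)
    · simp only [Function.comp, e, Sum.elim_inl, Option.elim]
      rcases Int.units_eq_one_or (χ a j) with h1 | h1 <;> simp [S.hr, h1]
    · exact S.h0 j i
  · rintro j (_ | i)
    · simp only [Function.comp, e, Sum.elim_inl, Option.elim]
      rcases Int.units_eq_one_or (χ a j) with h1 | h1 <;> simp [S.hr, ← h, h1]
    · exact S.h1 j i
  · intro j x; exact S.hr j x.1

end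

lemma exists_sys {n N : ℕ} (A : Fin n → Matrix (Fin N) (Fin N) ℝ)
    (hA : ∀ j, (A j)ᵀ * A j = 1) (hc : ∀ i j, A i * A j = A j * A i) :
    ∃ (κ ι : Type) (_ : DecidableEq κ) (_ : DecidableEq ι) (_ : Fintype κ) (_ : Fintype ι)
      (v : (Fin 2 × κ) ⊕ ι → Fin N → ℝ) (μ : κ → Fin n → Circle) (χ : ι → Fin n → ℤˣ),
      Sys A v μ χ ∧ Function.Injective χ ∧ 2 * Fintype.card κ + Fintype.card ι = N := by
  classical
  let p : ℕ → Prop := fun s => ∃ (κ ι : Type) (_ : DecidableEq κ) (_ : DecidableEq ι) (_ : Fintype κ) (_ : Fintype ι)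
      (v : (Fin 2 × κ) ⊕ ι → Fin N → ℝ) (μ : κ → Fin n → Circle) (χ : ι → Fin n → ℤˣ),
      Sys A v μ χ ∧ 3 * Fintype.card κ + Fintype.card ι = s
  have hb : ∀ s, p s → s ≤ 3 * N := by
    rintro s ⟨κ, ι, _, _, _, _, v, μ, χ, S, hs⟩
    have := S.card_le
    omega
  have h0 : p 0 := by
    refine ⟨Empty, Empty, inferInstance, inferInstance, inferInstance, inferInstance,
      fun i => (i.elim (fun q => q.2.elim) (fun q => q.elim)), fun i => i.elim, fun i => i.elim, ⟨?_, ?_, ?_, ?_⟩, by simp⟩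
    · rintro (⟨_, u⟩ | u) <;> exact u.elim
    · rintro _ ⟨⟩
    · rintro _ ⟨⟩
    · rintro _ ⟨⟩
  have hp := Nat.findGreatest_spec (P := p) (Nat.zero_le (3 * N)) h0
  have hmax : ∀ s, p s → s ≤ Nat.findGreatest p (3 * N) := fun s hs => Nat.le_findGreatest (hb s hs) hs
  set K := Nat.findGreatest p (3 * N) with hK
  obtain ⟨κ, ι, _, _, _, _, v, μ, χ, S, hs⟩ := hp
  refine ⟨κ, ι, inferInstance, inferInstance, inferInstance, inferInstance, v, μ, χ, S, ?_, ?_⟩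
  · intro a b hab
    by_contra hne
    obtain ⟨v', S'⟩ := S.merge a b hne hab
    have := hmax _ ⟨_, _, inferInstance, inferInstance, inferInstance, inferInstance, v', _, _, S', rfl⟩
    have hcard : Fintype.card {x // x ≠ a ∧ x ≠ b} + 2 = Fintype.card ι := by
      have h1 : Fintype.card {x // x ≠ a ∧ x ≠ b} = (Finset.univ \ {a, b}).card := by
        rw [Fintype.card_subtype]; congr 1; ext x; simp
      have h2 := Finset.card_sdiff_add_card_eq_card (Finset.subset_univ ({a, b} : Finset ι))
      rw [Finset.card_pair hne] at h2
      rw [h1, h2, Finset.card_univ]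
    rw [Fintype.card_option] at this
    omega
  · by_contra hne
    have hlt := lt_of_le_of_ne S.card_le hne
    obtain ⟨x, y, l, hxy, hx, hy, hAx, hAy⟩ := S.piece hA hc hlt
    have iso : ∀ j (u w : Fin N → ℝ), (A j *ᵥ u) ⬝ᵥ (A j *ᵥ w) = u ⬝ᵥ w := by
      intro j u w
      rw [Matrix.dotProduct_mulVec, Matrix.vecMul_mulVec, hA]
      simp
    have nn : ∀ u : Fin N → ℝ, 0 ≤ u ⬝ᵥ u := fun u => by simpa using dotProduct_star_self_nonneg u
    have np : ∀ u : Fin N → ℝ, u ≠ 0 → 0 < u ⬝ᵥ u := fun u hu =>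
      lt_of_le_of_ne (nn u) (fun h => hu (dotProduct_self_eq_zero.mp h.symm))
    have exx : ∀ j, x ⬝ᵥ x = (l j).re^2 * (x ⬝ᵥ x) - 2 * (l j).re * (l j).im * (x ⬝ᵥ y) + (l j).im^2 * (y ⬝ᵥ y) := by
      intro j
      conv_lhs => rw [← iso j, hAx]
      simp only [sub_dotProduct, dotProduct_sub, smul_dotProduct, dotProduct_smul, smul_eq_mul, dotProduct_comm y x]
      ring
    have eyy : ∀ j, y ⬝ᵥ y = (l j).im^2 * (x ⬝ᵥ x) + 2 * (l j).re * (l j).im * (x ⬝ᵥ y) + (l j).re^2 * (y ⬝ᵥ y) := by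
      intro j
      conv_lhs => rw [← iso j, hAy]
      simp only [add_dotProduct, dotProduct_add, smul_dotProduct, dotProduct_smul, smul_eq_mul, dotProduct_comm y x]
      ring
    have exy : ∀ j, x ⬝ᵥ y = (l j).re * (l j).im * (x ⬝ᵥ x - y ⬝ᵥ y) + ((l j).re^2 - (l j).im^2) * (x ⬝ᵥ y) := by
      intro j
      conv_lhs => rw [← iso j, hAy, hAx]
      simp only [add_dotProduct, dotProduct_add, sub_dotProduct, dotProduct_sub, smul_dotProduct, dotProduct_smul, smul_eq_mul, dotProduct_comm y x]
      ring
    have hpos : 0 < x ⬝ᵥ x + y ⬝ᵥ y := by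
      rcases hxy with h | h
      · linarith [np x h, nn y]
      · linarith [np y h, nn x]
    have hl1 : ∀ j, (l j).re^2 + (l j).im^2 = 1 := by
      intro j
      have : ((l j).re^2 + (l j).im^2 - 1) * (x ⬝ᵥ x + y ⬝ᵥ y) = 0 := by linear_combination -(exx j) - eyy j
      rcases mul_eq_zero.mp this with h | h
      · linarith
      · linarith
    have norm1 : ∀ (u : Fin N → ℝ) (s : ℝ), 0 < s → u ⬝ᵥ u = s → ((Real.sqrt s)⁻¹ • u) ⬝ᵥ ((Real.sqrt s)⁻¹ • u) = 1 := by
      intro u s hs hu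
      simp only [smul_dotProduct, dotProduct_smul, smul_eq_mul, hu]
      have := Real.mul_self_sqrt hs.le
      have h2 : Real.sqrt s ≠ 0 := (Real.sqrt_pos.mpr hs).ne'
      field_simp
      nlinarith
    by_cases him : ∀ j, (l j).im = 0
    · -- real case
      have hreal : ∃ w : Fin N → ℝ, w ≠ 0 ∧ (∀ i, v i ⬝ᵥ w = 0) ∧ ∀ j, A j *ᵥ w = (l j).re • w := by
        rcases hxy with h | h
        · exact ⟨x, h, hx, fun j => by rw [hAx, him]; simp⟩
        · exact ⟨y, h, hy, fun j => by rw [hAy, him]; simp⟩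
      obtain ⟨w, hw0, hvw, hAw⟩ := hreal
      have hunit : ∀ j, ∃ c : ℤˣ, (l j).re = ((c : ℤ) : ℝ) := by
        intro j
        have h := hl1 j
        rw [him] at h
        have : (l j).re^2 = 1 := by linarith
        rcases (by simpa using this : (l j).re = 1 ∨ (l j).re = -1) with h | h
        · exact ⟨1, by simp [h]⟩
        · exact ⟨-1, by simp [h]⟩
      choose c hcc using hunit
      have S' := S.extend_real ((Real.sqrt (w ⬝ᵥ w))⁻¹ • w) c (norm1 w _ (np w hw0) rfl)
        (fun i => by rw [dotProduct_smul, hvw, smul_zero])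
        (fun j => by rw [mulVec_smul, hAw, hcc, smul_comm])
      have := hmax _ ⟨_, _, inferInstance, inferInstance, inferInstance, inferInstance, _, _, _, S', rfl⟩
      rw [Fintype.card_option] at this
      omega
    · push Not at him
      obtain ⟨j, hj⟩ := him
      have hq : (x ⬝ᵥ x - y ⬝ᵥ y) = 0 ∧ x ⬝ᵥ y = 0 := by
        have e1 := exx j
        have e2 := eyy j
        have e3 := exy j
        have e4 := hl1 j
        set p := x ⬝ᵥ x - y ⬝ᵥ y with hp
        set q := x ⬝ᵥ y
        set r := (l j).re
        set s := (l j).im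
        have f1 : s * (s * p + 2 * r * q) = 0 := by
          have : r^2 = 1 - s^2 := by linarith
          rw [this] at e1 e2
          linear_combination e1 / 2 - e2 / 2
        have f2 : s * (r * p - 2 * s * q) = 0 := by
          have : r^2 = 1 - s^2 := by linarith
          rw [this] at e3
          linear_combination -e3
        have g1 := (mul_eq_zero.mp f1).resolve_left hj
        have g2 := (mul_eq_zero.mp f2).resolve_left hj
        constructor
        · linear_combination s * g1 + r * g2 - p * e4
        · linear_combination (r * g1 - s * g2) / 2 - q * e4
      obtain ⟨hq1, hq2⟩ := hq
      have hxpos : 0 < x ⬝ᵥ x := by linarith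
      have S' := S.extend_plane ((Real.sqrt (x ⬝ᵥ x))⁻¹ • y) ((Real.sqrt (x ⬝ᵥ x))⁻¹ • x)
        (fun j => ⟨l j, by
          refine mem_sphere_zero_iff_norm.mpr ?_
          rw [Complex.norm_def, Complex.normSq_apply]
          rw [Real.sqrt_eq_one]
          linarith [hl1 j]⟩)
        (norm1 _ _ hxpos (by linarith)) (norm1 _ _ hxpos rfl)
        (by simp only [smul_dotProduct, dotProduct_smul, dotProduct_comm y x, hq2, smul_zero])
        (fun i => by rw [dotProduct_smul, hy, smul_zero])
        (fun i => by rw [dotProduct_smul, hx, smul_zero])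
        (fun j => by rw [mulVec_smul, hAy]; simp only [smul_add, smul_smul]; rw [add_comm]; congr 1 <;> rw [mul_comm])
        (fun j => by
          rw [mulVec_smul, hAx]
          funext a
          simp
          ring)
      have := hmax _ ⟨_, _, inferInstance, inferInstance, inferInstance, inferInstance, _, _, _, S', rfl⟩
      rw [Fintype.card_option] at this
      omega
end WR

namespace WR
open Matrix

abbrev OG (N : ℕ) := Matrix.orthogonalGroup (Fin N) ℝ

lemma star_T {N : ℕ} (M : Matrix (Fin N) (Fin N) ℝ) : star M = Mᵀ := by
  rw [star_eq_conjTranspose, conjTranspose_eq_transpose_of_trivial]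

lemma og_inv {N : ℕ} (g : OG N) : ((g⁻¹ : OG N) : Matrix (Fin N) (Fin N) ℝ) = (g : Matrix (Fin N) (Fin N) ℝ)ᵀ := by
  rw [← star_T]; rfl

lemma og_mul_T {N : ℕ} (g : OG N) : (g : Matrix (Fin N) (Fin N) ℝ) * (g : Matrix (Fin N) (Fin N) ℝ)ᵀ = 1 := by
  rw [← star_T]; exact Matrix.mem_orthogonalGroup_iff (Fin N) ℝ |>.mp g.2

lemma og_T_mul {N : ℕ} (g : OG N) : (g : Matrix (Fin N) (Fin N) ℝ)ᵀ * (g : Matrix (Fin N) (Fin N) ℝ) = 1 := by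
  rw [← star_T]; exact Matrix.mem_orthogonalGroup_iff' (Fin N) ℝ |>.mp g.2

section
variable {κ ι : Type} [DecidableEq κ] [DecidableEq ι] [Fintype κ] [Fintype ι] {n N : ℕ}

/-- Tuples with a prescribed normal form. -/
def Sset (n N : ℕ) (κ : Type) {ι : Type} [DecidableEq κ] [DecidableEq ι] [Fintype κ] [Fintype ι]
    (χ : ι → Fin n → ℝ) : Set (CommTuples n (OG N)) :=
  {A | ∃ (P : Matrix (Fin N) ((Fin 2 × κ) ⊕ ι) ℝ) (z : κ → Fin n → Circle),
    Pᵀ * P = 1 ∧ P * Pᵀ = 1 ∧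
      ∀ j, (A.1 j : Matrix (Fin N) (Fin N) ℝ) = P * D (fun i => (z i j : ℂ)) (fun x => χ x j) * Pᵀ}

lemma D_continuous {Y : Type*} [TopologicalSpace Y] (z : Y → κ → ℂ) (c : ι → ℝ) (hz : Continuous z) :
    Continuous (fun y => D (z y) c) := by
  unfold D
  apply Continuous.matrix_fromBlocks _ continuous_const continuous_const continuous_const
  apply Continuous.matrix_blockDiagonal
  refine continuous_pi fun i => ?_
  have h := (continuous_apply i).comp hz
  have hre : Continuous fun y => (z y i).re := Complex.continuous_re.comp h
  have him : Continuous fun y => (z y i).im := Complex.continuous_im.comp h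
  refine continuous_matrix fun a b => ?_
  fin_cases a <;> fin_cases b <;> simp [rot]
  · exact hre
  · exact him.neg
  · exact him
  · exact hre

lemma coe_cont : Continuous (fun (A : CommTuples n (OG N)) j => (A.1 j : Matrix (Fin N) (Fin N) ℝ)) := by
  refine continuous_pi fun j => ?_
  exact continuous_subtype_val.comp ((continuous_apply j).comp continuous_subtype_val)

lemma Sset_closed (χ : ι → Fin n → ℝ) : IsClosed (Sset n N κ χ) := by
  let K : Set (Matrix (Fin N) ((Fin 2 × κ) ⊕ ι) ℝ) := {P | Pᵀ * P = 1 ∧ P * Pᵀ = 1}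
  have hbd : ∀ P : Matrix (Fin N) ((Fin 2 × κ) ⊕ ι) ℝ, Pᵀ * P = 1 → ∀ a i, P a i ∈ Set.Icc (-1 : ℝ) 1 := by
    intro P h1 a i
    have h := congrFun (congrFun h1 i) i
    rw [Matrix.mul_apply, one_apply_eq] at h
    simp only [transpose_apply] at h
    have h2 : P a i * P a i ≤ ∑ b, P b i * P b i :=
      Finset.single_le_sum (f := fun b => P b i * P b i) (fun b _ => mul_self_nonneg _) (Finset.mem_univ a)
    rw [h] at h2
    exact abs_le.mp (abs_le_one_iff_mul_self_le_one.mpr h2)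
  have hK : IsCompact K := by
    have hcl : IsClosed K := by
      apply IsClosed.inter
      · exact isClosed_eq (by fun_prop) continuous_const
      · exact isClosed_eq (by fun_prop) continuous_const
    have hc : IsCompact (Set.pi Set.univ fun _ : Fin N => Set.pi Set.univ fun _ : (Fin 2 × κ) ⊕ ι => Set.Icc (-1:ℝ) 1) :=
      isCompact_univ_pi fun _ => isCompact_univ_pi fun _ => isCompact_Icc
    refine hc.of_isClosed_subset hcl ?_
    rintro P ⟨h1, -⟩ a - i -
    exact hbd P h1 a i
  let f : Matrix (Fin N) ((Fin 2 × κ) ⊕ ι) ℝ × (κ → Fin n → Circle) → Fin n → Matrix (Fin N) (Fin N) ℝ :=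
    fun q j => q.1 * D (fun i => (q.2 i j : ℂ)) (fun x => χ x j) * q.1ᵀ
  have hf : Continuous f := by
    refine continuous_pi fun j => ?_
    have : Continuous fun q : Matrix (Fin N) ((Fin 2 × κ) ⊕ ι) ℝ × (κ → Fin n → Circle) => D (fun i => (q.2 i j : ℂ)) (fun x => χ x j) := by
      apply D_continuous
      fun_prop
    fun_prop
  have him := ((hK.prod (isCompact_univ (X := κ → Fin n → Circle))).image hf).isClosed
  convert him.preimage (coe_cont (n := n) (N := N)) using 1
  ext A
  constructor
  · rintro ⟨P, z, h1, h2, h3⟩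
    exact ⟨(P, z), ⟨⟨h1, h2⟩, trivial⟩, funext fun j => (h3 j).symm⟩
  · rintro ⟨⟨P, z⟩, ⟨⟨h1, h2⟩, -⟩, h3⟩
    exact ⟨P, z, h1, h2, fun j => (congrFun h3 j).symm⟩

lemma D_reindex {κ' ι' : Type} [DecidableEq κ'] [DecidableEq ι'] [Fintype κ'] [Fintype ι'] (e : κ ≃ κ') (e' : ι ≃ ι')
    (z : κ' → ℂ) (c : ι' → ℝ) :
    D z c = (D (z ∘ e) (c ∘ e')).submatrix (Equiv.sumCongr ((Equiv.refl (Fin 2)).prodCongr e) e').symm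
      (Equiv.sumCongr ((Equiv.refl (Fin 2)).prodCongr e) e').symm := by
  ext (⟨t, i⟩ | x) (⟨t', i'⟩ | x') <;> simp [D, blockDiagonal_apply, diagonal_apply]

lemma form_reindex {κ' ι' : Type} [DecidableEq κ'] [DecidableEq ι'] [Fintype κ'] [Fintype ι'] (e : κ ≃ κ') (e' : ι ≃ ι')
    (χ : ι' → Fin n → ℝ) (A : Fin n → Matrix (Fin N) (Fin N) ℝ)
    (P : Matrix (Fin N) ((Fin 2 × κ') ⊕ ι') ℝ) (z : κ' → Fin n → Circle)
    (h1 : Pᵀ * P = 1) (h2 : P * Pᵀ = 1)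
    (h3 : ∀ j, A j = P * D (fun i => (z i j : ℂ)) (fun x => χ x j) * Pᵀ) :
    ∃ P' : Matrix (Fin N) ((Fin 2 × κ) ⊕ ι) ℝ, P'ᵀ * P' = 1 ∧ P' * P'ᵀ = 1 ∧
      ∀ j, A j = P' * D (fun i => (z (e i) j : ℂ)) (fun x => χ (e' x) j) * P'ᵀ := by
  set E := Equiv.sumCongr ((Equiv.refl (Fin 2)).prodCongr e) e' with hE
  refine ⟨P.submatrix id E, ?_, ?_, ?_⟩
  · rw [transpose_submatrix, submatrix_mul _ _ _ id _ Function.bijective_id |>.symm, h1]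
    exact submatrix_one_equiv E
  · rw [transpose_submatrix, submatrix_mul _ _ _ E _ E.bijective |>.symm, h2]
    simp
  · intro j
    rw [h3, D_reindex e e', ← hE]
    have : P * (D ((fun i => (z i j : ℂ)) ∘ e) ((fun x => χ x j) ∘ e')).submatrix E.symm E.symm
       = (P.submatrix id E * (D ((fun i => (z i j : ℂ)) ∘ e) ((fun x => χ x j) ∘ e'))).submatrix id E.symm := by
      rw [submatrix_mul _ _ _ E.symm _ E.symm.bijective]; simp
    rw [this]
    have : Pᵀ = ((P.submatrix id E)ᵀ).submatrix E.symm id := by simp [transpose_submatrix]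
    conv_lhs => rw [this]
    rw [← submatrix_mul _ _ _ E.symm _ E.symm.bijective]
    simp
    rfl

lemma Sset_reindex {κ' ι' : Type} [DecidableEq κ'] [DecidableEq ι'] [Fintype κ'] [Fintype ι'] (e : κ ≃ κ') (e' : ι ≃ ι')
    (χ : ι' → Fin n → ℝ) (A : CommTuples n (OG N)) (h : A ∈ Sset n N κ' χ) : A ∈ Sset n N κ (χ ∘ e') := by
  obtain ⟨P, z, h1, h2, h3⟩ := h
  obtain ⟨P', h1', h2', h3'⟩ := form_reindex e e' χ _ P z h1 h2 h3
  exact ⟨P', z ∘ e, h1', h2', h3'⟩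

lemma cover (A : CommTuples n (OG N)) : ∃ (k : Fin (N + 1)) (X : Finset (Fin n → ℤˣ)), 2 * k.1 + X.card = N ∧
    A ∈ Sset n N (Fin k) (fun (x : X) j => (((x.1 j : ℤˣ) : ℤ) : ℝ)) := by
  classical
  obtain ⟨κ, ι, _, _, _, _, v, μ, χ, S, hinj, hcard⟩ := exists_sys (fun j => (A.1 j : Matrix (Fin N) (Fin N) ℝ))
    (fun j => og_T_mul _) (fun i j => congrArg Subtype.val (A.2 i j))
  let X : Finset (Fin n → ℤˣ) := Finset.univ.image χ
  have hX : X.card = Fintype.card ι := Finset.card_image_of_injective _ hinj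
  have hmem : A ∈ Sset n N κ (fun (x : ι) j => (((χ x j : ℤˣ) : ℤ) : ℝ)) := by
    have h1 : (of v)ᵀᵀ * (of v)ᵀ = 1 := by rw [transpose_transpose]; exact S.gram
    have h2 : (of v)ᵀ * (of v)ᵀᵀ = 1 := by
      refine (Matrix.mul_eq_one_comm_of_card_eq _ _ _ ?_).mp h1
      simp; omega
    refine ⟨(of v)ᵀ, μ, h1, h2, fun j => ?_⟩
    rw [← S.act, Matrix.mul_assoc, h2, Matrix.mul_one]
  let e : X ≃ ι := (Equiv.ofBijective (fun x : ι => (⟨χ x, Finset.mem_image_of_mem _ (Finset.mem_univ _)⟩ : X))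
    ⟨fun a b h => hinj (congrArg Subtype.val h), fun ⟨y, hy⟩ => by
      obtain ⟨x, -, hx⟩ := Finset.mem_image.mp hy
      exact ⟨x, Subtype.ext hx⟩⟩).symm
  have he : ∀ x, χ (e x) = x.1 := fun x => by
    have : e.symm (e x) = x := e.symm_apply_apply x
    exact congrArg Subtype.val this
  refine ⟨⟨Fintype.card κ, by omega⟩, X, by simp only [hX]; omega, ?_⟩
  have := Sset_reindex (Fintype.equivFin κ).symm e _ A hmem
  convert this using 1
  congr 1
  funext x j
  simp [he]

end

/-- base-change permutation matrix -/
noncomputable def EM (m : ℕ) : Matrix (Fin (2 * m + 1)) ((Fin 2 × Fin m) ⊕ Fin 1) ℝ :=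
  (1 : Matrix ((Fin 2 × Fin m) ⊕ Fin 1) ((Fin 2 × Fin m) ⊕ Fin 1) ℝ).submatrix (blockIndexEquiv m).symm id

lemma EM_T_mul (m : ℕ) : (EM m)ᵀ * EM m = 1 := by
  rw [EM, transpose_submatrix, ← submatrix_mul _ _ _ _ _ (blockIndexEquiv m).symm.bijective]; simp

lemma EM_mul_T (m : ℕ) : EM m * (EM m)ᵀ = 1 := by
  rw [EM, transpose_submatrix, ← submatrix_mul _ _ _ _ _ Function.bijective_id]; simp

lemma bigMat_eq (m : ℕ) (z : Fin m → ℂ) : bigMat m z = EM m * D z (fun _ : Fin 1 => (1 : ℝ)) * (EM m)ᵀ := by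
  have : bigMat m z = (D z (fun _ : Fin 1 => (1 : ℝ))).submatrix (blockIndexEquiv m).symm (blockIndexEquiv m).symm := by
    simp [bigMat, D]
  rw [this, EM, transpose_submatrix]
  have h : (D z (fun _ : Fin 1 => (1:ℝ))) = (D z (fun _ : Fin 1 => (1:ℝ))).submatrix id id := by simp
  conv_rhs => rw [h]
  rw [← submatrix_mul _ _ _ _ _ Function.bijective_id, ← submatrix_mul _ _ _ _ _ Function.bijective_id]
  simp

lemma bigMat_orth (m : ℕ) (z : Fin m → Circle) : bigMat m (fun i => (z i : ℂ)) ∈ OG (2 * m + 1) := by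
  rw [Matrix.mem_orthogonalGroup_iff', bigMat_eq]
  simp only [transpose_mul, transpose_transpose, Matrix.mul_assoc]
  rw [← Matrix.mul_assoc (EM m)ᵀ (EM m), EM_T_mul, Matrix.one_mul, ← Matrix.mul_assoc (D _ _)ᵀ]
  have := D_transpose_mul (ι := Fin 1) z
  have h1 : (fun _ => 1 : Fin 1 → ℝ) = 1 := rfl
  rw [h1, this, Matrix.one_mul, EM_mul_T]

/-- The map `T^m → C_n(O(2m+1))`. -/
noncomputable def FF (n m : ℕ) (lam : Fin m → Fin n → Circle) : CommTuples n (OG (2 * m + 1)) :=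
  ⟨fun j => ⟨bigMat m (fun i => (lam i j : ℂ)), bigMat_orth m _⟩, fun i j => Subtype.ext (by
    change bigMat _ _ * bigMat _ _ = bigMat _ _ * bigMat _ _
    simp only [bigMat_eq]
    have : ∀ X Y : Matrix ((Fin 2 × Fin m) ⊕ Fin 1) ((Fin 2 × Fin m) ⊕ Fin 1) ℝ,
      EM m * X * (EM m)ᵀ * (EM m * Y * (EM m)ᵀ) = EM m * (X * Y) * (EM m)ᵀ := by
      intro X Y
      simp only [Matrix.mul_assoc]
      rw [← Matrix.mul_assoc (EM m)ᵀ (EM m), EM_T_mul, Matrix.one_mul]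
    rw [this, this, D_comm])⟩

lemma FF_cont (n m : ℕ) : Continuous (FF n m) := by
  refine Continuous.subtype_mk (continuous_pi fun j => Continuous.subtype_mk ?_ _) _
  simp only [bigMat_eq]
  have : Continuous fun q : Fin m → Fin n → Circle => D (fun i => (q i j : ℂ)) (fun _ : Fin 1 => (1:ℝ)) := by
    apply D_continuous
    fun_prop
  fun_prop

/-- The good set. -/
def S0 (n m : ℕ) : Set (CommTuples n (OG (2 * m + 1))) :=
  Sset n (2 * m + 1) (Fin m) (fun (_ : Fin 1) _ => (1:ℝ))

lemma repRel_of_form (n m : ℕ) (A : CommTuples n (OG (2 * m + 1)))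
    (P : Matrix (Fin (2 * m + 1)) ((Fin 2 × Fin m) ⊕ Fin 1) ℝ) (z : Fin m → Fin n → Circle)
    (h2 : P * Pᵀ = 1)
    (h3 : ∀ j, (A.1 j : Matrix (Fin (2 * m + 1)) (Fin (2 * m + 1)) ℝ) =
      P * D (fun i => (z i j : ℂ)) (fun _ : Fin 1 => (1 : ℝ)) * Pᵀ) :
    repRel n _ (FF n m z) A := by
  refine ⟨⟨P * (EM m)ᵀ, ?_⟩, fun j => Subtype.ext ?_⟩
  · rw [Matrix.mem_orthogonalGroup_iff, transpose_mul, transpose_transpose, Matrix.mul_assoc,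
      ← Matrix.mul_assoc (EM m)ᵀ, EM_T_mul, Matrix.one_mul, h2]
  · change _ = P * (EM m)ᵀ * bigMat m _ * _
    rw [og_inv, h3, bigMat_eq]
    simp only [transpose_mul, transpose_transpose, Matrix.mul_assoc]
    rw [← Matrix.mul_assoc (EM m)ᵀ (EM m), EM_T_mul, Matrix.one_mul, ← Matrix.mul_assoc (EM m)ᵀ (EM m), EM_T_mul, Matrix.one_mul]

lemma mem_S0 (n m : ℕ) (A : CommTuples n (OG (2 * m + 1))) :
    A ∈ S0 n m ↔ ∃ lam, repRel n _ (FF n m lam) A := by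
  constructor
  · rintro ⟨P, z, h1, h2, h3⟩
    exact ⟨z, repRel_of_form n m A P z h2 h3⟩
  · rintro ⟨z, g, hg⟩
    refine ⟨g.1 * EM m, z, ?_, ?_, fun j => ?_⟩
    · rw [transpose_mul, Matrix.mul_assoc, ← Matrix.mul_assoc g.1ᵀ, og_T_mul, Matrix.one_mul, EM_T_mul]
    · rw [transpose_mul, Matrix.mul_assoc, ← Matrix.mul_assoc (EM m), EM_mul_T, Matrix.one_mul, og_mul_T]
    · have := congrArg Subtype.val (hg j)
      rw [this]
      change g.1 * bigMat m _ * (g⁻¹ : OG _).1 = _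
      rw [og_inv, bigMat_eq, transpose_mul]
      simp only [Matrix.mul_assoc]

lemma FF_mem_S0 (n m : ℕ) (lam) : FF n m lam ∈ S0 n m := (mem_S0 n m _).mpr ⟨lam, 1, fun i => by simp⟩

lemma S0_compl (n m : ℕ) : (S0 n m)ᶜ = ⋃ k : Fin (2 * m + 1 + 1), ⋃ X : {X : Finset (Fin n → ℤˣ) // X ≠ {1}},
    Sset n (2 * m + 1) (Fin k) (fun (x : X.1) j => (((x.1 j : ℤˣ) : ℤ) : ℝ)) := by
  ext A
  simp only [Set.mem_compl_iff, Set.mem_iUnion]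
  constructor
  · intro hA
    obtain ⟨k, X, hc, h⟩ := cover A
    refine ⟨k, ⟨X, ?_⟩, h⟩
    rintro rfl
    apply hA
    have hk : k.1 = m := by simp at hc; omega
    let e' : Fin 1 ≃ ({1} : Finset (Fin n → ℤˣ)) :=
      Fintype.equivOfCardEq (by simp)
    have := Sset_reindex (finCongr hk.symm) e' _ A h
    unfold S0
    convert this using 1
    congr 1
    funext x j
    have := Finset.mem_singleton.mp (e' x).2
    simp [this]
  · rintro ⟨k, ⟨X, hX⟩, P, z, h1, h2, h3⟩ ⟨P', z', h1', h2', h3'⟩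
    apply hX
    apply chars_X (fun i j => (z' i j : ℂ)) (fun i j => (z i j : ℂ))
    apply multiset_eq
    intro w
    rw [← trace_word _ _ P h1 h2 _ h3, ← trace_word _ _ P' h1' h2' _ h3']

lemma S0_clopen (n m : ℕ) : IsClopen (S0 n m) := by
  refine ⟨Sset_closed _, ?_⟩
  rw [← isClosed_compl_iff, S0_compl]
  exact isClosed_iUnion_of_finite fun k => isClosed_iUnion_of_finite fun X => Sset_closed _

lemma trace_FF (n m : ℕ) (lam) (w : FreeMonoid (Fin n)) :
    (((FreeMonoid.lift (fun j => ((FF n m lam).1 j : Matrix (Fin (2 * m + 1)) (Fin (2 * m + 1)) ℝ)) w).trace : ℝ) : ℂ) =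
      ((chars (fun i j => (lam i j : ℂ)) (fun (_ : Fin 1) _ => (1:ℝ))).map (fun c => wd c w)).sum := by
  apply trace_word _ _ (EM m) (EM_T_mul m) (EM_mul_T m)
  intro j
  exact bigMat_eq m _

/-- trace of words on Rep -/
noncomputable def trW (n N : ℕ) (A : RepSpace n (OG N)) (w : FreeMonoid (Fin n)) : ℝ :=
  Quot.lift (fun A : CommTuples n (OG N) =>
    (FreeMonoid.lift (fun j => (A.1 j : Matrix (Fin N) (Fin N) ℝ)) w).trace) (by
      rintro A B ⟨g, hg⟩
      have : FreeMonoid.lift (fun j => (B.1 j : Matrix (Fin N) (Fin N) ℝ)) w =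
          g.1 * FreeMonoid.lift (fun j => (A.1 j : Matrix (Fin N) (Fin N) ℝ)) w * g.1ᵀ := by
        induction w using FreeMonoid.inductionOn' with
        | one => simp [og_mul_T]
        | of_mul a w ih =>
          rw [map_mul, map_mul, ih, FreeMonoid.lift_eval_of, FreeMonoid.lift_eval_of, hg]
          change g.1 * (A.1 a).1 * (g⁻¹ : OG N).1 * _ = _
          rw [og_inv]
          simp only [Matrix.mul_assoc]
          rw [← Matrix.mul_assoc g.1ᵀ g.1, og_T_mul, Matrix.one_mul]
      change _ = (FreeMonoid.lift (fun j => (B.1 j : Matrix (Fin N) (Fin N) ℝ)) w).trace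
      rw [this, Matrix.mul_assoc, trace_mul_comm, Matrix.mul_assoc, og_T_mul, Matrix.mul_one]) A

lemma trW_cont (n N : ℕ) : Continuous (trW n N) := by
  refine continuous_pi fun w => ?_
  have h : Continuous (fun A : CommTuples n (OG N) =>
    (FreeMonoid.lift (fun j => (A.1 j : Matrix (Fin N) (Fin N) ℝ)) w).trace) := by
    apply Continuous.matrix_trace
    induction w using FreeMonoid.inductionOn' with
    | one => simpa using continuous_const
    | of_mul a w ih =>
      simp only [map_mul, FreeMonoid.lift_eval_of]
      exact ((continuous_apply a).comp coe_cont).matrix_mul ih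
  exact continuous_quot_lift _ h

end WR

namespace WR
open Matrix

/-- block reflection -/
noncomputable def QQ (m : ℕ) (ε : Fin m → Bool) : Matrix ((Fin 2 × Fin m) ⊕ Fin 1) ((Fin 2 × Fin m) ⊕ Fin 1) ℝ :=
  diagonal (Sum.elim (fun p => if p.1 = 1 ∧ ε p.2 = true then -1 else 1) (fun _ => 1))

lemma QQ_T (m : ℕ) (ε : Fin m → Bool) : (QQ m ε)ᵀ = QQ m ε := by simp [QQ]

lemma QQ_sq (m : ℕ) (ε : Fin m → Bool) : QQ m ε * QQ m ε = 1 := by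
  rw [QQ, diagonal_mul_diagonal, ← diagonal_one]
  congr 1
  funext i
  rcases i with p | x
  · simp only [Sum.elim_inl]; split_ifs <;> norm_num
  · simp

lemma QQ_conj (m : ℕ) (ε : Fin m → Bool) (z : Fin m → ℂ) :
    D (fun i => if ε i then (starRingEnd ℂ) (z i) else z i) (fun _ : Fin 1 => (1 : ℝ)) =
      QQ m ε * D z (fun _ : Fin 1 => (1 : ℝ)) * QQ m ε := by
  ext i i'
  rw [QQ, mul_diagonal, diagonal_mul]
  rcases i with ⟨t, i⟩ | x <;> rcases i' with ⟨t', i'⟩ | x'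
  · by_cases h : i = i'
    · subst h
      cases hε : ε i <;> fin_cases t <;> fin_cases t' <;> simp [D, rot, blockDiagonal_apply, hε]
    · simp [D, blockDiagonal_apply, h]
  · simp [D]
  · simp [D]
  · simp [D]

lemma wreath_rep (n m : ℕ) (a b : Fin m → Fin n → Circle) (h : wreathRel n m a b) :
    repRel n _ (FF n m a) (FF n m b) := by
  obtain ⟨σ, ε, h⟩ := h
  let P := EM m * QQ m ε
  have h1 : Pᵀ * P = 1 := by
    simp only [P, transpose_mul, Matrix.mul_assoc]
    rw [← Matrix.mul_assoc (EM m)ᵀ, EM_T_mul, Matrix.one_mul, QQ_T, QQ_sq]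
  have h2 : P * Pᵀ = 1 := by
    simp only [P, transpose_mul, Matrix.mul_assoc]
    rw [← Matrix.mul_assoc (QQ m ε), QQ_T, QQ_sq, Matrix.one_mul, EM_mul_T]
  have h3 : ∀ j, ((FF n m b).1 j : Matrix (Fin (2 * m + 1)) (Fin (2 * m + 1)) ℝ) =
      P * D (fun i => (a (σ i) j : ℂ)) (fun _ : Fin 1 => (1 : ℝ)) * Pᵀ := by
    intro j
    change bigMat m _ = _
    rw [bigMat_eq]
    have : (fun i => (b i j : ℂ)) = fun i => if ε i then (starRingEnd ℂ) (a (σ i) j : ℂ) else (a (σ i) j : ℂ) :=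
      funext fun i => h i j
    rw [this, QQ_conj]
    simp only [P, transpose_mul, Matrix.mul_assoc, QQ_T]
  obtain ⟨P', h1', h2', h3'⟩ := form_reindex σ.symm (Equiv.refl (Fin 1)) (fun _ _ => (1:ℝ)) _ P (a ∘ σ) h1 h2 h3
  refine repRel_of_form n m _ P' a h2' (fun j => ?_)
  rw [h3']
  simp

/-- induced map -/
noncomputable def hmap (n m : ℕ) : Quot (wreathRel n m) → RepSpace n (OG (2 * m + 1)) :=
  Quot.lift (fun lam => Quot.mk _ (FF n m lam)) (fun a b h => Quot.sound (wreath_rep n m a b h))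

lemma hmap_cont (n m : ℕ) : Continuous (hmap n m) :=
  continuous_quot_lift _ (continuous_quot_mk.comp (FF_cont n m))

lemma hmap_emb (n m : ℕ) : Topology.IsEmbedding (hmap n m) := by
  have hc : Continuous (trW n (2 * m + 1) ∘ hmap n m) := (trW_cont n _).comp (hmap_cont n m)
  have hi : Function.Injective (trW n (2 * m + 1) ∘ hmap n m) := by
    intro x y
    induction x using Quot.ind with | _ a =>
    induction y using Quot.ind with | _ b =>
    intro h
    apply Quot.sound
    apply chars_wreath
    apply multiset_eq
    intro w
    rw [← trace_FF, ← trace_FF]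
    have := congrFun h w
    exact congrArg Complex.ofReal this
  exact Topology.IsEmbedding.of_comp (hmap_cont n m) (trW_cont n _) (hc.isClosedEmbedding hi).isEmbedding

lemma one_eq (n m : ℕ) : FF n m (fun _ _ => 1) = oneTuple n _ := by
  refine Subtype.ext (funext fun j => Subtype.ext ?_)
  change bigMat m _ = 1
  have : D (fun _ : Fin m => ((1 : Circle) : ℂ)) (fun _ : Fin 1 => (1 : ℝ)) = 1 := by
    rw [← D_one]; congr 1
  rw [bigMat_eq, this, Matrix.mul_one, EM_mul_T]

lemma hmap_range (n m : ℕ) : Set.range (hmap n m) =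
    (pathComponent (Quot.mk (repRel n (OG (2 * m + 1))) (oneTuple n _)) : Set (RepSpace n (OG (2 * m + 1)))) := by
  have h1 : hmap n m (Quot.mk _ (fun _ _ => 1)) = Quot.mk (repRel n (OG (2 * m + 1))) (oneTuple n _) := by
    rw [← one_eq]; rfl
  apply Set.Subset.antisymm
  · rintro _ ⟨x, rfl⟩
    induction x using Quot.ind with | _ a =>
    have hj : Joined (fun _ _ => 1 : Fin m → Fin n → Circle) a := PathConnectedSpace.joined _ _
    have := hj.map (f := fun lam => hmap n m (Quot.mk _ lam)) ((hmap_cont n m).comp continuous_quot_mk)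
    rw [← h1]
    exact this
  · refine (pathComponent_subset_component _).trans ?_
    apply IsClopen.connectedComponent_subset
    · have hpre : (Quot.mk (repRel n (OG (2 * m + 1)))) ⁻¹' (Set.range (hmap n m)) = S0 n m := by
        ext A
        constructor
        · rintro ⟨x, hx⟩
          induction x using Quot.ind with | _ a =>
          have hx : Quot.mk (repRel n (OG (2 * m + 1))) (FF n m a) = Quot.mk _ A := hx
          have heq : Equivalence (repRel n (OG (2 * m + 1))) := by
            refine ⟨fun x => ⟨1, fun i => by simp⟩, ?_, ?_⟩
            · rintro x y ⟨g, hg⟩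
              exact ⟨g⁻¹, fun i => by rw [hg]; group⟩
            · rintro x y z ⟨g, hg⟩ ⟨k, hk⟩
              exact ⟨k * g, fun i => by rw [hk, hg]; group⟩
          exact (mem_S0 n m A).mpr ⟨a, (heq.quot_mk_eq_iff _ _).mp hx⟩
        · intro hA
          obtain ⟨a, ha⟩ := (mem_S0 n m A).mp hA
          exact ⟨Quot.mk _ a, Quot.sound ha⟩
      have hq : Topology.IsQuotientMap (Quot.mk (repRel n (OG (2 * m + 1))) : _ → RepSpace n (OG (2 * m + 1))) :=
        isQuotientMap_quot_mk
      refine (hq.isClopen_preimage).mp ?_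
      exact hpre ▸ S0_clopen n m
    · exact ⟨_, h1⟩

end WR

/-- The continuous map `T^m → C_n(O(2m+1))` sending `(λ₁, …, λ_m)` to the commuting
`n`-tuple `(A₁, …, Aₙ)` of block-diagonal orthogonal matrices with blocks
`R(λ₁⁽ʲ⁾), …, R(λ_m⁽ʲ⁾), (1)` descends to a homeomorphism from the quotient of `T^m` by
the wreath product `C₂ ≀ Σ_m` onto the path component of the trivial tuple in
`Rep_n(O(2m+1))`. -/
theorem wreath_quotient_homeomorph_pathComponent_repSpace_orthogonal (n m : ℕ)
    (hn : 1 ≤ n) (hm : 1 ≤ m) :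
    ∃ F : (Fin m → Fin n → Circle) →
        CommTuples n (Matrix.orthogonalGroup (Fin (2 * m + 1)) ℝ),
      (∀ lam j, ((F lam).1 j : Matrix (Fin (2 * m + 1)) (Fin (2 * m + 1)) ℝ) =
          bigMat m (fun i => (lam i j : ℂ))) ∧
      Continuous F ∧
      ∃ h : Quot (wreathRel n m) ≃ₜ
          (pathComponent
            (Quot.mk (repRel n (Matrix.orthogonalGroup (Fin (2 * m + 1)) ℝ))
              (oneTuple n _)) :
            Set (RepSpace n (Matrix.orthogonalGroup (Fin (2 * m + 1)) ℝ))),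
        ∀ lam, ((h (Quot.mk (wreathRel n m) lam)) :
            RepSpace n (Matrix.orthogonalGroup (Fin (2 * m + 1)) ℝ)) =
          Quot.mk (repRel n _) (F lam) := by
  refine ⟨WR.FF n m, fun lam j => rfl, WR.FF_cont n m,
    (WR.hmap_emb n m).toHomeomorph.trans (Homeomorph.setCongr (WR.hmap_range n m)), fun lam => rfl⟩
end
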